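/- arXiv:1510.00530 — 5 statements merged into one kernel-verified Lean document; each statement's English description precedes it below -/
import Mathlib

section
/- Let K be a field of characteristic ≠ 2, n ≥ 2, and 𝔤 = sl_n(K) regarded as a Lie ring, acting on an abelian group V via an additive map ρ : 𝔤 → End_ℤ(V) with ρ([x,y]) = ρ(x)∘ρ(y) − ρ(y)∘ρ(x). Suppose every root subring acts quadratically: for all i ≠ j and all λ, μ ∈ K, ρ(λE_{ij})∘ρ(μE_{ij}) = 0. Then V = Ann_V(𝔤) ⊕ 𝔤·V, and there exists a K-vector space structure on 𝔤·V (with the given addition) for which every ρ(x) (x ∈ 𝔤) restricts to a K-linear endomorphism of 𝔤·V and ρ(λx) = λ·ρ(x) on 𝔤·V for all λ ∈ K and x ∈ 𝔤. -/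
/-!
STATEMENT 3: Let K be a field of characteristic ≠ 2, n ≥ 2, and 𝔤 = sl_n(K) regarded as a
Lie ring, acting on an abelian group V via an additive map ρ : 𝔤 → End_ℤ(V) with
ρ([x,y]) = ρ(x)∘ρ(y) − ρ(y)∘ρ(x).  Suppose every root subring acts quadratically:
for all i ≠ j and all λ, μ ∈ K, ρ(λE_{ij})∘ρ(μE_{ij}) = 0.  Then V = Ann_V(𝔤) ⊕ 𝔤·V,
and there exists a K-vector space structure on 𝔤·V (with the given addition) for which
every ρ(x) restricts to a K-linear endomorphism of 𝔤·V and ρ(λx) = λ·ρ(x) on 𝔤·V.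
-/

open LieAlgebra.SpecialLinear

noncomputable section

/-- `sl_n(K)`, the trace-zero n×n matrices over `K`, as a Lie ring. -/
abbrev sln (n : ℕ) (K : Type*) [Field K] := LieAlgebra.SpecialLinear.sl (Fin n) K

/-- `Ann_V(𝔤) = {v ∈ V : ρ(x)v = 0 for all x ∈ 𝔤}`. -/
def annV (n : ℕ) (K V : Type*) [Field K] [AddCommGroup V]
    (ρ : sln n K →+ AddMonoid.End V) : AddSubgroup V where
  carrier := {v | ∀ x : sln n K, ρ x v = 0}
  zero_mem' := by intro x; simp
  add_mem' := by intro a b ha hb x; rw [map_add, ha, hb, add_zero]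
  neg_mem' := by intro a ha x; rw [map_neg, ha, neg_zero]

/-- `𝔤·V`, the subgroup of `V` generated by `{ρ(x)v : x ∈ 𝔤, v ∈ V}`. -/
def gV (n : ℕ) (K V : Type*) [Field K] [AddCommGroup V]
    (ρ : sln n K →+ AddMonoid.End V) : AddSubgroup V :=
  AddSubgroup.closure {w | ∃ (x : sln n K) (v : V), w = ρ x v}

/-- Operators satisfying the relations of the root elements `λ E_{ij}` and of the coroot elements
`λ (E_{ii} - E_{jj})` of `sl_n(K)`, with all root elements acting quadratically. -/
structure QuadraticRootOps (ι K R : Type*) [Field K] [Ring R] where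
  /-- The root operators. -/
  X : ι → ι → K →+ R
  /-- The coroot operators. -/
  H : ι → ι → K →+ R
  X_mul_X : ∀ {i j}, i ≠ j → ∀ a b, X i j a * X i j b = 0
  X_opp : ∀ {i j}, i ≠ j → ∀ a b, X i j a * X j i b - X j i b * X i j a = H i j (a * b)
  H_X : ∀ {i j}, i ≠ j → ∀ a b,
    H i j a * X i j b - X i j b * H i j a = X i j (a * b) + X i j (a * b)
  X_chain : ∀ {i j l}, i ≠ j → j ≠ l → i ≠ l → ∀ a b,
    X i j a * X j l b - X j l b * X i j a = X i l (a * b)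
  X_comm : ∀ {i j k l}, i ≠ j → k ≠ l → j ≠ k → i ≠ l → ∀ a b,
    X i j a * X k l b = X k l b * X i j a
  H_comm : ∀ i j k l a b, H i j a * H k l b = H k l b * H i j a

/-- Additive maps out of a vector space over a field with `2 ≠ 0` have no `2`-torsion values. -/
theorem AddMonoidHom.apply_eq_of_add_self_eq {K R : Type*} [Field K] [AddGroup R]
    (h2 : (2 : K) ≠ 0) (f g : K →+ R) (h : ∀ a, f a + f a = g a + g a) (a : K) : f a = g a := by
  have := h (a / 2)
  rwa [← map_add, ← map_add, ← two_mul, mul_div_cancel₀ _ h2] at this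

namespace QuadraticRootOps

variable {ι K R : Type*} [Field K] [Ring R] (Q : QuadraticRootOps ι K R)

theorem X_mul_X_mul_X {i j : ι} (hij : i ≠ j) (a b c : K) :
    Q.X i j a * Q.X j i b * Q.X i j c = Q.H i j (a * b) * Q.X i j c := by
  rw [← Q.X_opp hij, sub_mul, mul_assoc (Q.X j i b), Q.X_mul_X hij, mul_zero, sub_zero]

theorem H_mul_X_eq_neg {i j : ι} (hij : i ≠ j) (a b c : K) :
    Q.H i j (a * b) * Q.X i j c = -(Q.X i j a * Q.H i j (c * b)) := by
  rw [← Q.X_mul_X_mul_X hij, ← Q.X_opp hij, mul_sub, ← mul_assoc, Q.X_mul_X hij]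
  noncomm_ring

theorem H_mul_X (h2 : (2 : K) ≠ 0) {i j : ι} (hij : i ≠ j) (a b : K) :
    Q.H i j a * Q.X i j b = Q.X i j (a * b) := by
  refine AddMonoidHom.apply_eq_of_add_self_eq h2
    ((AddMonoidHom.mulRight (Q.X i j b)).comp (Q.H i j))
    ((Q.X i j).comp (AddMonoidHom.mulRight b)) (fun a => ?_) a
  have h := Q.H_X hij a b
  have e1 := Q.H_mul_X_eq_neg hij b 1 a
  have e2 := Q.H_mul_X_eq_neg hij 1 b a
  have e3 := Q.H_mul_X_eq_neg hij 1 a b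
  simp only [mul_one, one_mul] at e1 e2 e3
  simp only [AddMonoidHom.comp_apply, AddMonoidHom.coe_mulRight]
  rw [← h, e3, mul_comm b a, ← e2, e1]
  noncomm_ring

theorem X_mul_H (h2 : (2 : K) ≠ 0) {i j : ι} (hij : i ≠ j) (a b : K) :
    Q.X i j b * Q.H i j a = -Q.X i j (a * b) := by
  have h := Q.H_X hij a b
  rw [Q.H_mul_X h2 hij] at h
  rwa [sub_eq_add_neg, add_right_inj, neg_eq_iff_eq_neg] at h

theorem H_swap {i j : ι} (hij : i ≠ j) (a : K) : Q.H j i a = -Q.H i j a := by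
  have h1 := Q.X_opp hij 1 a
  have h2 := Q.X_opp hij.symm a 1
  rw [one_mul] at h1
  rw [mul_one] at h2
  rw [← h1, ← h2, neg_sub]

theorem X_mul_X_opp (h2 : (2 : K) ≠ 0) {i j : ι} (hij : i ≠ j) (l a b : K) :
    Q.X i j (l * a) * Q.X j i b = Q.X i j a * Q.X j i (l * b) := by
  rw [← neg_inj, ← neg_mul, ← Q.X_mul_H h2 hij, mul_assoc, ← neg_neg (Q.H i j l),
    ← Q.H_swap hij, neg_mul, Q.H_mul_X h2 hij.symm, mul_neg]

/-- The operators twisted by the automorphism `A ↦ -Aᵀ`. -/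
def negTranspose : QuadraticRootOps ι K R where
  X i j := -Q.X j i
  H i j := -Q.H i j
  X_mul_X hij a b := by simp [Q.X_mul_X hij.symm]
  X_opp hij a b := by
    simp only [AddMonoidHom.neg_apply, neg_mul_neg]
    rw [Q.X_opp hij.symm, Q.H_swap hij]
  H_X hij a b := by
    simp only [AddMonoidHom.neg_apply, neg_mul_neg]
    rw [← neg_add, ← Q.H_X hij.symm, Q.H_swap hij]
    noncomm_ring
  X_chain hij hjl hil a b := by
    simp only [AddMonoidHom.neg_apply, neg_mul_neg]
    rw [mul_comm a b, ← Q.X_chain hjl.symm hij.symm hil.symm, neg_sub]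
  X_comm hij hkl hjk hil a b := by
    simp only [AddMonoidHom.neg_apply, neg_mul_neg]
    exact Q.X_comm hij.symm hkl.symm hil hjk a b
  H_comm i j k l a b := by
    simp only [AddMonoidHom.neg_apply, neg_mul_neg, Q.H_comm i j k l]

theorem X_mul_X_of_row (h2 : (2 : K) ≠ 0) {i j l : ι} (hij : i ≠ j) (hjl : j ≠ l)
    (hil : i ≠ l) (a b : K) : Q.X i j a * Q.X i l b = 0 := by
  have left : ∀ a b c, Q.X i j a * Q.X i l (b * c) = -(Q.X i j a * Q.X j l c * Q.X i j b) := by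
    intro a b c
    rw [← Q.X_chain hij hjl hil, mul_sub, ← mul_assoc, Q.X_mul_X hij]
    noncomm_ring
  have right : ∀ a b c, Q.X i l (b * c) * Q.X i j a = Q.X i j b * Q.X j l c * Q.X i j a := by
    intro a b c
    rw [← Q.X_chain hij hjl hil, sub_mul, mul_assoc (Q.X j l c), Q.X_mul_X hij]
    noncomm_ring
  have comm : ∀ a b, Q.X i j a * Q.X i l b = Q.X i l b * Q.X i j a :=
    fun a b => Q.X_comm hij hil hij.symm hil a b
  have one : ∀ x, Q.X i j 1 * Q.X i l x = 0 := by
    intro x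
    refine AddMonoidHom.apply_eq_of_add_self_eq h2
      ((AddMonoidHom.mulLeft (Q.X i j 1)).comp (Q.X i l)) 0 (fun x => ?_) x
    have e1 := left 1 1 x
    have e2 := right 1 1 x
    rw [one_mul] at e1 e2
    rw [← e2, ← comm] at e1
    simpa [eq_neg_iff_add_eq_zero] using e1
  have e1 := right 1 a b
  have e2 := left a 1 b
  have e3 := right 1 1 (a * b)
  rw [← comm, one] at e1
  rw [one_mul, ← e1] at e2
  simpa using e2

theorem X_mul_X_of_col (h2 : (2 : K) ≠ 0) {i j l : ι} (hij : i ≠ j) (hjl : j ≠ l)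
    (hil : i ≠ l) (a b : K) : Q.X i l a * Q.X j l b = 0 := by
  have h := Q.negTranspose.X_mul_X_of_row h2 hil.symm hij hjl.symm a b
  rwa [← neg_mul_neg]

theorem X_mul_X_chain (h2 : (2 : K) ≠ 0) {i j l : ι} (hij : i ≠ j) (hjl : j ≠ l)
    (hil : i ≠ l) (c a b : K) : Q.X i j (c * a) * Q.X j l b = Q.X i j a * Q.X j l (c * b) := by
  have key : ∀ c a b, Q.X i j (c * a) * Q.X j l b = Q.X i j 1 * Q.X j l (c * (a * b)) := by
    intro c a b
    have e1 := Q.X_mul_X_mul_X hij 1 c a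
    rw [one_mul, Q.H_mul_X h2 hij] at e1
    have e2 := Q.X_chain hij hjl hil a b
    have e3 := Q.X_chain hij.symm hil hjl c (a * b)
    have e4 : Q.X j i c * Q.X j l b = 0 := Q.X_mul_X_of_row h2 hij.symm hil hjl c b
    have e5 : Q.X i j 1 * Q.X i l (a * b) = 0 := Q.X_mul_X_of_row h2 hij hjl hil 1 (a * b)
    rw [sub_eq_iff_eq_add] at e2 e3
    rw [← e1, mul_assoc, e2, mul_add, mul_assoc, e3, mul_assoc, ← mul_assoc (Q.X j i c), e4,
      zero_mul, mul_zero, add_zero, mul_add, ← mul_assoc (Q.X i j 1), e5, zero_mul, add_zero]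
  have h := key a 1 (c * b)
  rw [mul_one] at h
  rw [key, h]
  congr 2
  ring

theorem X_mul_X_disjoint (h2 : (2 : K) ≠ 0) {i j k l : ι} (hij : i ≠ j) (hkl : k ≠ l)
    (hik : i ≠ k) (hil : i ≠ l) (hjk : j ≠ k) (hjl : j ≠ l) (a b : K) :
    Q.X i j a * Q.X k l b = -(Q.X i l 1 * Q.X k j (b * a)) := by
  have e1 := Q.X_chain hil hjl.symm hij 1 a
  have e2 := Q.X_chain hkl hjl.symm hjk.symm b a
  have e3 := Q.X_mul_X_of_col h2 hik hkl hil 1 b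
  rw [one_mul] at e1
  rw [← e1, ← e2, mul_sub, ← mul_assoc, e3, sub_mul, mul_assoc (Q.X l j a), e3]
  noncomm_ring

theorem X_assoc (h2 : (2 : K) ≠ 0) {i j k l : ι} (hij : i ≠ j) (hkl : k ≠ l) (c a b : K) :
    Q.X i j (c * a) * Q.X k l b = Q.X i j a * Q.X k l (c * b) := by
  by_cases hjk : j = k
  · subst hjk
    by_cases hil : i = l
    · subst hil
      exact Q.X_mul_X_opp h2 hij c a b
    · exact Q.X_mul_X_chain h2 hij hkl hil c a b
  by_cases hil : i = l
  · subst hil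
    have e1 := Q.X_chain hkl hij (Ne.symm hjk) b (c * a)
    have e2 := Q.X_chain hkl hij (Ne.symm hjk) (c * b) a
    have e3 := Q.X_mul_X_chain h2 hkl hij (Ne.symm hjk) c b a
    rw [sub_eq_iff_eq_add, ← sub_eq_iff_eq_add'] at e1 e2
    rw [← e1, ← e2, e3, mul_left_comm, mul_assoc]
  by_cases hik : i = k
  · subst hik
    by_cases hjl : j = l
    · subst hjl
      rw [Q.X_mul_X hij, Q.X_mul_X hij]
    · rw [Q.X_mul_X_of_row h2 hij hjl hil, Q.X_mul_X_of_row h2 hij hjl hil]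
  by_cases hjl : j = l
  · subst hjl
    rw [Q.X_mul_X_of_col h2 hik hkl hij, Q.X_mul_X_of_col h2 hik hkl hij]
  · rw [Q.X_mul_X_disjoint h2 hij hkl hik hil hjk hjl,
      Q.X_mul_X_disjoint h2 hij hkl hik hil hjk hjl, mul_left_comm, mul_assoc]

/-- A product of commuting projections `1 - H i j 1 ^ 2` annihilates the root operators. -/
theorem exists_annihilator (h2 : (2 : K) ≠ 0) (N : NonUnitalSubring R)
    (hN : ∀ i j, Q.H i j 1 ∈ N) (s : Finset (ι × ι)) (hs : ∀ p ∈ s, p.1 ≠ p.2) :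
    ∃ T : R, 1 - T ∈ N ∧ (∀ i j, T * Q.H i j 1 = Q.H i j 1 * T) ∧
      ∀ p ∈ s, ∀ a, T * Q.X p.1 p.2 a = 0 ∧ Q.X p.1 p.2 a * T = 0 := by
  classical
  induction s using Finset.induction_on with
  | empty => exact ⟨1, by simp [N.zero_mem], by simp, by simp⟩
  | insert p s hp ih =>
    obtain ⟨T, hTN, hTH, hTX⟩ := ih fun q hq => hs q (Finset.mem_insert_of_mem hq)
    have hne := hs p (Finset.mem_insert_self p s)
    set e := Q.H p.1 p.2 1 * Q.H p.1 p.2 1 with he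
    have heN : e ∈ N := N.mul_mem (hN _ _) (hN _ _)
    have hTe : T * e = e * T := by
      rw [he, ← mul_assoc, hTH, mul_assoc, hTH, mul_assoc]
    have heH : ∀ i j, e * Q.H i j 1 = Q.H i j 1 * e := by
      intro i j
      rw [he, mul_assoc, Q.H_comm _ _ i j, ← mul_assoc, Q.H_comm _ _ i j, mul_assoc]
    have heX : ∀ a, e * Q.X p.1 p.2 a = Q.X p.1 p.2 a := by
      intro a
      rw [he, mul_assoc, Q.H_mul_X h2 hne, Q.H_mul_X h2 hne, one_mul, one_mul]
    have hXe : ∀ a, Q.X p.1 p.2 a * e = Q.X p.1 p.2 a := by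
      intro a
      rw [he, ← mul_assoc, Q.X_mul_H h2 hne, neg_mul, Q.X_mul_H h2 hne, one_mul, one_mul, neg_neg]
    refine ⟨T - T * e, ?_, ?_, ?_⟩
    · have : 1 - (T - T * e) = (1 - T) + e - (1 - T) * e := by noncomm_ring
      rw [this]
      exact N.sub_mem (N.add_mem hTN heN) (N.mul_mem hTN heN)
    · intro i j
      rw [sub_mul, mul_assoc, heH, ← mul_assoc, hTH, mul_sub, mul_assoc]
    · intro q hq a
      rcases Finset.mem_insert.1 hq with rfl | hq
      · refine ⟨by rw [sub_mul, mul_assoc, heX, sub_self], ?_⟩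
        rw [hTe, mul_sub, ← mul_assoc, hXe, sub_self]
      · obtain ⟨h, h'⟩ := hTX q hq a
        refine ⟨?_, by rw [mul_sub, ← mul_assoc, h', zero_mul, sub_zero]⟩
        rw [hTe, sub_mul, mul_assoc, h, mul_zero, sub_zero]

end QuadraticRootOps

namespace LieAlgebra.SpecialLinear

variable {ι K : Type*} [Fintype ι] [DecidableEq ι] [Field K]

theorem mem_of_single_mem [Nonempty ι] (S : AddSubgroup (sl ι K))
    (hX : ∀ i j (h : i ≠ j) a, single i j h a ∈ S) (hH : ∀ i j a, singleSubSingle i j a ∈ S)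
    (x : sl ι K) : x ∈ S := by
  obtain ⟨o⟩ := ‹Nonempty ι›
  have htr : ∑ i, x.1 i i = 0 := x.2
  have hx : x = ∑ i, ∑ j, (if h : i ≠ j then single i j h (x.1 i j) else 0) +
      ∑ i, singleSubSingle i o (x.1 i i) := by
    have hentry : ∀ i j, ((if h : i ≠ j then single i j h (x.1 i j) else 0 : sl ι K)).1 =
        Matrix.single i j (x.1 i j) - if i = j then Matrix.single i i (x.1 i i) else 0 := by
      intro i j
      by_cases h : i = j
      · subst h; simp
      · simp [h]
    apply Subtype.ext
    simp only [AddMemClass.coe_add, AddSubmonoidClass.coe_finsetSum, hentry,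
      val_singleSubSingle, Finset.sum_sub_distrib, Finset.sum_ite_eq, Finset.mem_univ, if_true]
    have h0 : ∑ i, Matrix.single o o (x.1 i i) = 0 := by
      have := map_sum (Matrix.singleAddMonoidHom o o : K →+ Matrix ι ι K) (fun i => x.1 i i)
        Finset.univ
      rw [htr, map_zero] at this
      exact this.symm
    rw [h0, sub_zero, sub_add_cancel]
    exact Matrix.matrix_eq_sum_single x.1
  rw [hx]
  refine S.add_mem (S.sum_mem fun i _ => S.sum_mem fun j _ => ?_) (S.sum_mem fun i _ => hH _ _ _)
  split_ifs with h
  · exact hX _ _ _ _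
  · exact S.zero_mem

theorem lie_single_opp {i j : ι} (h : i ≠ j) (a b : K) :
    ⁅single i j h a, single j i h.symm b⁆ = singleSubSingle i j (a * b) := by
  apply Subtype.ext
  simp [Ring.lie_def, mul_comm]

theorem lie_single_chain {i j l : ι} (hij : i ≠ j) (hjl : j ≠ l) (hil : i ≠ l) (a b : K) :
    ⁅single i j hij a, single j l hjl b⁆ = single i l hil (a * b) := by
  apply Subtype.ext
  simp [Ring.lie_def, Matrix.single_mul_single_of_ne, hil.symm]

theorem lie_single_comm {i j k l : ι} (hij : i ≠ j) (hkl : k ≠ l) (hjk : j ≠ k) (hil : i ≠ l)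
    (a b : K) : ⁅single i j hij a, single k l hkl b⁆ = 0 := by
  apply Subtype.ext
  simp [Ring.lie_def, Matrix.single_mul_single_of_ne, hil.symm, hjk]

theorem lie_singleSubSingle_single {i j : ι} (hij : i ≠ j) (a b : K) :
    ⁅singleSubSingle i j a, single i j hij b⁆ =
      single i j hij (a * b) + single i j hij (a * b) := by
  apply Subtype.ext
  simp [Ring.lie_def, sub_mul, mul_sub, Matrix.single_mul_single_of_ne, hij.symm, mul_comm]

theorem lie_singleSubSingle (i j k l : ι) (a b : K) :
    ⁅singleSubSingle i j a, singleSubSingle k l b⁆ = 0 := by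
  have h : ∀ (i k : ι), Matrix.single i i a * Matrix.single k k b =
      Matrix.single k k b * Matrix.single i i a := by
    intro i k
    by_cases hik : i = k
    · subst hik; simp [mul_comm]
    · simp [Matrix.single_mul_single_of_ne, hik, Ne.symm hik]
  apply Subtype.ext
  simp only [sl_bracket, val_singleSubSingle, sub_mul, mul_sub, h, ZeroMemClass.coe_zero]
  abel

end LieAlgebra.SpecialLinear

section Representation

variable {n : ℕ} {K V : Type*} [Field K] [AddCommGroup V] (ρ : sln n K →+ AddMonoid.End V)

/-- The root and coroot operators of a quadratic action of `sl_n(K)`. -/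
def rootOps (hbracket : ∀ x y : sln n K, ρ ⁅x, y⁆ = ρ x * ρ y - ρ y * ρ x)
    (hquad : ∀ (i j : Fin n) (hij : i ≠ j) (lam mu : K),
      ρ (lam • single i j hij (1 : K)) * ρ (mu • single i j hij (1 : K)) = 0) :
    QuadraticRootOps (Fin n) K (AddMonoid.End V) where
  X i j := if h : i ≠ j then ρ.comp (single i j h).toAddMonoidHom else 0
  H i j := ρ.comp (singleSubSingle i j).toAddMonoidHom
  X_mul_X {i j} hij a b := by
    have h := hquad i j hij a b
    rw [← map_smul, ← map_smul, smul_eq_mul, smul_eq_mul, mul_one, mul_one] at h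
    simpa [hij] using h
  X_opp hij a b := by
    simp [hij, hij.symm, ← hbracket, lie_single_opp]
  H_X hij a b := by
    simp [hij, ← hbracket, lie_singleSubSingle_single]
  X_chain hij hjl hil a b := by
    simp [hij, hjl, hil, ← hbracket, lie_single_chain]
  X_comm hij hkl hjk hil a b := by
    rw [← sub_eq_zero]
    simp [hij, hkl, ← hbracket, lie_single_comm, hjk, hil]
  H_comm i j k l a b := by
    rw [← sub_eq_zero]
    simp [← hbracket, lie_singleSubSingle]

variable (hbracket : ∀ x y : sln n K, ρ ⁅x, y⁆ = ρ x * ρ y - ρ y * ρ x)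
    (hquad : ∀ (i j : Fin n) (hij : i ≠ j) (lam mu : K),
      ρ (lam • single i j hij (1 : K)) * ρ (mu • single i j hij (1 : K)) = 0)

theorem rootOps_X {i j : Fin n} (h : i ≠ j) (a : K) :
    (rootOps ρ hbracket hquad).X i j a = ρ (single i j h a) := by
  simp [rootOps, h]

theorem rootOps_H (i j : Fin n) (a : K) :
    (rootOps ρ hbracket hquad).H i j a = ρ (singleSubSingle i j a) := rfl

theorem apply_mem_gV (x : sln n K) (v : V) : ρ x v ∈ gV n K V ρ :=
  AddSubgroup.subset_closure ⟨x, v, rfl⟩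

include hbracket hquad

/-- Scalars can be moved across a product of two operators of a quadratic action. -/
theorem smul_mul_eq_mul_smul [NeZero n] (h2 : (2 : K) ≠ 0) (c : K) (y x : sln n K) :
    ρ (c • y) * ρ x = ρ y * ρ (c • x) := by
  let Q := rootOps ρ hbracket hquad
  have hX : ∀ {i j : Fin n} (h : i ≠ j) a, ρ (single i j h a) = Q.X i j a :=
    fun h a => (rootOps_X ρ hbracket hquad h a).symm
  have hH : ∀ {i j : Fin n}, i ≠ j → ∀ a, ρ (singleSubSingle i j a) =
      Q.X i j a * Q.X j i 1 - Q.X j i 1 * Q.X i j a := fun h a => by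
    rw [Q.X_opp h, mul_one]; rfl
  have hHz : ∀ (i : Fin n) (a : K), singleSubSingle i i a = 0 := fun i a => by
    apply Subtype.ext; simp
  have root : ∀ {k m : Fin n}, k ≠ m → ∀ (x : sln n K) c b,
      Q.X k m (c * b) * ρ x = Q.X k m b * ρ (c • x) := by
    intro k m hkm x
    let S : AddSubgroup (sln n K) :=
      { carrier := {x | ∀ c b : K, Q.X k m (c * b) * ρ x = Q.X k m b * ρ (c • x)}
        zero_mem' := by intro c b; simp
        add_mem' := by
          intro x y hx hy c b
          rw [map_add, mul_add, hx, hy, smul_add, map_add, mul_add]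
        neg_mem' := by
          intro x hx c b
          rw [map_neg, mul_neg, hx, smul_neg, map_neg, mul_neg] }
    refine mem_of_single_mem S ?_ ?_ x
    · intro i j hij a c b
      rw [← map_smul, hX, hX, smul_eq_mul, Q.X_assoc h2 hkm hij]
    · intro i j a c b
      by_cases hij : i = j
      · subst hij; simp [hHz]
      · rw [← map_smul, hH hij, hH hij, mul_sub, mul_sub, ← mul_assoc, ← mul_assoc,
          Q.X_assoc h2 hkm hij, Q.X_assoc h2 hkm (Ne.symm hij), mul_assoc (Q.X k m b) (Q.X j i _),
          Q.X_assoc h2 (Ne.symm hij) hij, smul_eq_mul]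
        noncomm_ring
  let S : AddSubgroup (sln n K) :=
    { carrier := {y | ∀ (c : K) (x : sln n K), ρ (c • y) * ρ x = ρ y * ρ (c • x)}
      zero_mem' := by intro c x; simp
      add_mem' := by
        intro y z hy hz c x
        rw [map_add, add_mul, ← hy, ← hz, smul_add, map_add, add_mul]
      neg_mem' := by
        intro y hy c x
        rw [map_neg, neg_mul, ← hy, smul_neg, map_neg, neg_mul] }
  refine mem_of_single_mem S ?_ ?_ y c x
  · intro i j hij a c x
    rw [← map_smul, hX, hX, smul_eq_mul, root hij]
  · intro i j a c x
    by_cases hij : i = j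
    · subst hij; simp [hHz]
    · have e := root (Ne.symm hij) x c 1
      rw [← map_smul, hH hij, hH hij, sub_mul, sub_mul, mul_assoc (Q.X j i 1), smul_eq_mul,
        root hij, Q.X_assoc h2 hij (Ne.symm hij), mul_assoc, e]
      noncomm_ring

theorem exists_projection_onto_annV [NeZero n] (h2 : (2 : K) ≠ 0) :
    ∃ T : AddMonoid.End V, (∀ v, v - T v ∈ gV n K V ρ) ∧ (∀ v ∈ annV n K V ρ, T v = v) ∧
      (∀ x, T * ρ x = 0) ∧ ∀ x, ρ x * T = 0 := by
  let Q := rootOps ρ hbracket hquad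
  let N : NonUnitalSubring (AddMonoid.End V) :=
    { carrier := {S | ∀ v, S v ∈ gV n K V ρ ∧ (v ∈ annV n K V ρ → S v = 0)}
      zero_mem' := fun v => ⟨(gV n K V ρ).zero_mem, fun _ => rfl⟩
      add_mem' := fun {S S'} h h' v => ⟨(gV n K V ρ).add_mem (h v).1 (h' v).1, fun hv =>
        (congrArg₂ (· + ·) ((h v).2 hv) ((h' v).2 hv)).trans (add_zero 0)⟩
      neg_mem' := fun {S} h v => ⟨(gV n K V ρ).neg_mem (h v).1, fun hv =>
        (congrArg Neg.neg ((h v).2 hv)).trans neg_zero⟩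
      mul_mem' := fun {S S'} h h' v => ⟨(h (S' v)).1, fun hv =>
        (congrArg S ((h' v).2 hv)).trans (map_zero S)⟩ }
  have hN : ∀ i j, Q.H i j 1 ∈ N := fun i j v => ⟨apply_mem_gV ρ _ v, fun hv => hv _⟩
  obtain ⟨T, hTN, hTH, hTX⟩ := Q.exists_annihilator h2 N hN
    (Finset.univ.filter fun p => p.1 ≠ p.2) (fun p hp => (Finset.mem_filter.1 hp).2)
  have hTX' : ∀ {i j : Fin n}, i ≠ j → ∀ a, T * Q.X i j a = 0 ∧ Q.X i j a * T = 0 :=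
    fun {i j} h a => hTX (i, j) (Finset.mem_filter.2 ⟨Finset.mem_univ _, h⟩) a
  have hall : ∀ x, T * ρ x = 0 ∧ ρ x * T = 0 := by
    let S : AddSubgroup (sln n K) :=
      { carrier := {x | T * ρ x = 0 ∧ ρ x * T = 0}
        zero_mem' := by simp
        add_mem' := by
          rintro x y ⟨hx, hx'⟩ ⟨hy, hy'⟩
          simp only [Set.mem_ofPred_eq, map_add, mul_add, add_mul, hx, hx', hy, hy', add_zero,
            and_self]
        neg_mem' := by
          rintro x ⟨hx, hx'⟩
          simp only [Set.mem_ofPred_eq, map_neg, mul_neg, neg_mul, hx, hx', neg_zero, and_self] }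
    refine mem_of_single_mem S (fun i j h a => ?_) (fun i j a => ?_)
    · have := hTX' h a
      rwa [rootOps_X ρ hbracket hquad h] at this
    · by_cases hij : i = j
      · subst hij
        have : singleSubSingle i i a = 0 := by apply Subtype.ext; simp
        rw [this]
        exact S.zero_mem
      · have e := Q.X_opp hij a 1
        rw [mul_one] at e
        change T * Q.H i j a = 0 ∧ Q.H i j a * T = 0
        rw [← e, mul_sub, sub_mul, ← mul_assoc, ← mul_assoc, mul_assoc _ _ T, mul_assoc _ _ T,
          (hTX' hij a).1, (hTX' hij a).2, (hTX' (Ne.symm hij) 1).1, (hTX' (Ne.symm hij) 1).2]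
        simp
  exact ⟨T, fun v => (hTN v).1, fun v hv => (sub_eq_zero.1 ((hTN v).2 hv)).symm,
    fun x => (hall x).1, fun x => (hall x).2⟩

theorem isCompl_annV_gV [NeZero n] (h2 : (2 : K) ≠ 0) : IsCompl (annV n K V ρ) (gV n K V ρ) := by
  obtain ⟨T, hT, hTann, hTρ, hρT⟩ := exists_projection_onto_annV ρ hbracket hquad h2
  constructor
  · rw [AddSubgroup.disjoint_def]
    intro v hv hv'
    rw [← hTann v hv]
    have hle : gV n K V ρ ≤ AddMonoidHom.ker T := by
      refine (AddSubgroup.closure_le _).2 ?_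
      rintro _ ⟨x, w, rfl⟩
      exact DFunLike.congr_fun (hTρ x) w
    exact hle hv'
  · rw [codisjoint_iff, eq_top_iff]
    intro v _
    rw [← add_sub_cancel (T v) v]
    exact AddSubgroup.add_mem_sup (fun x => DFunLike.congr_fun (hρT x) v) (hT v)

theorem exists_smul_gV [NeZero n] (h2 : (2 : K) ≠ 0) (c : K) (w : gV n K V ρ) :
    ∃ w' : gV n K V ρ, ∀ x, ρ x w' = ρ (c • x) w := by
  obtain ⟨w, hw⟩ := w
  induction hw using AddSubgroup.closure_induction with
  | mem w hw =>
    obtain ⟨x, v, rfl⟩ := hw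
    exact ⟨⟨ρ (c • x) v, apply_mem_gV ρ _ v⟩, fun y =>
      (DFunLike.congr_fun (smul_mul_eq_mul_smul ρ hbracket hquad h2 c y x) v).symm⟩
  | zero => exact ⟨0, fun x => by simp⟩
  | add v w hv hw ihv ihw =>
    obtain ⟨v', hv'⟩ := ihv
    obtain ⟨w', hw'⟩ := ihw
    exact ⟨v' + w', fun x => by simp [hv', hw']⟩
  | neg v hv ih =>
    obtain ⟨v', hv'⟩ := ih
    exact ⟨-v', fun x => by simp [hv']⟩

theorem gV_ext [NeZero n] (h2 : (2 : K) ≠ 0) {v w : gV n K V ρ}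
    (h : ∀ x, ρ x v = ρ x w) : v = w := by
  have hd := (isCompl_annV_gV ρ hbracket hquad h2).disjoint
  rw [AddSubgroup.disjoint_def] at hd
  rw [← sub_eq_zero]
  refine Subtype.ext (hd (fun x => ?_) (v - w).2)
  simp [h]

end Representation


theorem stmt3 (n : ℕ) (hn : 2 ≤ n) (K V : Type*) [Field K] (hchar : ringChar K ≠ 2)
    [AddCommGroup V]
    (ρ : sln n K →+ AddMonoid.End V)
    (hbracket : ∀ x y : sln n K, ρ ⁅x, y⁆ = ρ x * ρ y - ρ y * ρ x)
    -- every root subring acts quadratically: `λ • Eb K i j _ = λE_{ij}`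
    (hquad : ∀ (i j : Fin n) (hij : i ≠ j) (lam mu : K),
      ρ (lam • single i j hij (1 : K)) * ρ (mu • single i j hij (1 : K)) = 0) :
    -- V = Ann_V(𝔤) ⊕ 𝔤·V
    IsCompl (annV n K V ρ) (gV n K V ρ) ∧
    -- a K-vector space structure on 𝔤·V, with the given addition
    ∃ _ : Module K (gV n K V ρ),
      ∃ hinv : ∀ (x : sln n K) (v : V), v ∈ gV n K V ρ → ρ x v ∈ gV n K V ρ,
        -- every ρ(x) restricts to a K-linear endomorphism of 𝔤·V
        (∀ (x : sln n K) (lam : K) (v : gV n K V ρ),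
          (⟨ρ x ↑(lam • v), hinv x _ (lam • v).2⟩ : gV n K V ρ) =
            lam • (⟨ρ x ↑v, hinv x _ v.2⟩ : gV n K V ρ)) ∧
        -- ρ(λx) = λ·ρ(x) on 𝔤·V
        (∀ (x : sln n K) (lam : K) (v : gV n K V ρ),
          ρ (lam • x) ↑v = ↑(lam • (⟨ρ x ↑v, hinv x _ v.2⟩ : gV n K V ρ))) := by
  have : NeZero n := ⟨by omega⟩
  have h2 : (2 : K) ≠ 0 := Ring.two_ne_zero hchar
  have hassoc : ∀ (c : K) (y x : sln n K) (v : V), ρ (c • y) (ρ x v) = ρ y (ρ (c • x) v) :=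
    fun c y x v => DFunLike.congr_fun (smul_mul_eq_mul_smul ρ hbracket hquad h2 c y x) v
  have hext : ∀ {v w : gV n K V ρ}, (∀ x, ρ x v = ρ x w) → v = w :=
    gV_ext ρ hbracket hquad h2
  refine ⟨isCompl_annV_gV ρ hbracket hquad h2, ?_⟩
  choose sm hsm using exists_smul_gV ρ hbracket hquad h2
  let M : Module K (gV n K V ρ) :=
    { smul := sm
      one_smul := fun v => hext fun x => by
        change ρ x (sm 1 v) = _
        rw [hsm, one_smul]
      mul_smul := fun a b v => hext fun x => by
        change ρ x (sm (a * b) v) = ρ x (sm a (sm b v))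
        rw [hsm, hsm, hsm, mul_comm, mul_smul]
      smul_zero := fun a => hext fun x => by
        change ρ x (sm a 0) = _
        rw [hsm]
        simp
      smul_add := fun a v w => hext fun x => by
        change ρ x (sm a (v + w)) = ρ x ((sm a v : V) + sm a w)
        rw [map_add, hsm, hsm, hsm, AddSubgroup.coe_add, map_add]
      add_smul := fun a b v => hext fun x => by
        change ρ x (sm (a + b) v) = ρ x ((sm a v : V) + sm b v)
        rw [map_add, hsm, hsm, hsm, add_smul, map_add]
        rfl
      zero_smul := fun v => hext fun x => by
        change ρ x (sm 0 v) = _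
        rw [hsm]
        simp }
  refine ⟨M, fun x v _ => apply_mem_gV ρ x v, fun x c v => hext fun y => ?_, fun x c v => ?_⟩
  · change ρ y (ρ x (sm c v)) = ρ y (sm c ⟨ρ x v, _⟩)
    rw [hsm, hsm, ← hassoc]
  · refine congrArg Subtype.val (?_ : (⟨ρ (c • x) v, apply_mem_gV ρ _ _⟩ : gV n K V ρ) =
      sm c ⟨ρ x v, apply_mem_gV ρ _ _⟩)
    refine hext fun y => ?_
    rw [hsm, ← hassoc]
end
end

section
/- Let K be a field of characteristic ≠ 2, 𝔤 = sl₂(K) regarded as a Lie ring, and V a quadratic 𝔤-module. Set ω = id_V − ρ(h)² + ρ(e) − ρ(f) and ω' = id_V − ρ(h)² − ρ(e) + ρ(f) in End_ℤ(V). Then ω∘ω' = ω'∘ω = id_V (so ω is invertible with inverse ω'), and for every λ ∈ K: ω ∘ ρ(λe) ∘ ω' = −ρ(λf). -/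
/-!
STATEMENT 8: Let K be a field of characteristic ≠ 2, 𝔤 = sl₂(K) regarded as a Lie ring,
and V a quadratic 𝔤-module.  Set ω = id_V − ρ(h)² + ρ(e) − ρ(f) and
ω' = id_V − ρ(h)² − ρ(e) + ρ(f) in End_ℤ(V).  Then ω∘ω' = ω'∘ω = id_V, and for every λ ∈ K:
ω ∘ ρ(λe) ∘ ω' = −ρ(λf).
-/

open LieAlgebra.SpecialLinear

noncomputable section

/-- `sl₂(K)`, the trace-zero 2×2 matrices over `K`, as a Lie ring. -/
abbrev sl2 (K : Type*) [Field K] := LieAlgebra.SpecialLinear.sl (Fin 2) K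

/-- `e = E₁₂`. -/
def sl2e (K : Type*) [Field K] : sl2 K := single 0 1 (by decide) (1 : K)

/-- `f = E₂₁`. -/
def sl2f (K : Type*) [Field K] : sl2 K := single 1 0 (by decide) (1 : K)

/-- `h = E₁₁ − E₂₂`. -/
def sl2h (K : Type*) [Field K] : sl2 K :=
  ⟨!![1, 0; 0, -1], LinearMap.mem_ker.mpr (by simp [Matrix.trace_fin_two])⟩

/-- In a quadratic representation the semisimple part scales the nilpotent part:
`H a * E b = E (a * b)` and `E b * H a = -E (a * b)`. -/
theorem quadratic_weight {K R : Type*} [Field K] [Ring R] (h2 : (2 : K) ≠ 0) (E F H : K →+ R)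
    (hEE : ∀ a b, E a * E b = 0) (hEF : ∀ a b, E a * F b - F b * E a = H (a * b))
    (hHE : ∀ a b, H a * E b - E b * H a = E (a * b) + E (a * b)) (a b : K) :
    H a * E b = E (a * b) ∧ E b * H a = -E (a * b) := by
  have right : E b * H a = -E (a * b) := by
    rcases eq_or_ne b 0 with rfl | hb
    · simp
    set c := b / 2 with hc
    have hcc : b = c + c := by rw [hc, ← add_div, ← two_mul, mul_div_cancel_left₀ _ h2]
    have key : H a * E c = -(E c * H a) := by
      have hca : c * (a / c) = a := mul_div_cancel₀ a (div_ne_zero hb h2)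
      rw [← hca, ← hEF, sub_mul, mul_sub, mul_assoc (F _), hEE, ← mul_assoc (E c) (E c), hEE]
      noncomm_ring
    have h := hHE a c
    rw [key] at h
    rw [hcc, mul_add, map_add, map_add, add_mul, ← h]
    abel
  refine ⟨?_, right⟩
  rw [sub_eq_iff_eq_add.mp (hHE a b), right]
  abel

/-- The Weyl element identities for a quadratic triple of additive maps satisfying the
`sl₂` relations. -/
theorem quadratic_weyl {K R : Type*} [Field K] [Ring R] (h2 : (2 : K) ≠ 0) (E F H : K →+ R)
    (hEE : ∀ a b, E a * E b = 0) (hFF : ∀ a b, F a * F b = 0)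
    (hEF : ∀ a b, E a * F b - F b * E a = H (a * b))
    (hHE : ∀ a b, H a * E b - E b * H a = E (a * b) + E (a * b))
    (hHF : ∀ a b, H a * F b - F b * H a = -(F (a * b) + F (a * b))) :
    (1 - H 1 ^ 2 + E 1 - F 1) * (1 - H 1 ^ 2 - E 1 + F 1) = 1 ∧
      (1 - H 1 ^ 2 - E 1 + F 1) * (1 - H 1 ^ 2 + E 1 - F 1) = 1 ∧
      ∀ a, (1 - H 1 ^ 2 + E 1 - F 1) * E a * (1 - H 1 ^ 2 - E 1 + F 1) = -F a := by
  have hE := quadratic_weight h2 E F H hEE hEF hHE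
  have hF : ∀ a b, (-H) a * F b = F (a * b) ∧ F b * (-H) a = -F (a * b) := by
    refine quadratic_weight h2 F E (-H) hFF (fun a b => ?_) (fun a b => ?_)
    · rw [AddMonoidHom.neg_apply, mul_comm, ← hEF, neg_sub]
    · rw [AddMonoidHom.neg_apply, ← neg_inj, neg_sub, ← hHF]
      noncomm_ring
  have hHE1 : ∀ a, H 1 * E a = E a := fun a => by simpa using (hE 1 a).1
  have hEH1 : ∀ a, E a * H 1 = -E a := fun a => by simpa using (hE 1 a).2
  have hHF1 : ∀ a, H 1 * F a = -F a := fun a => by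
    simpa [neg_eq_iff_eq_neg] using (hF 1 a).1
  have hFH1 : ∀ a, F a * H 1 = F a := fun a => by simpa using (hF 1 a).2
  have hFH : ∀ a, F 1 * H a = F a := fun a => by simpa using (hF a 1).2
  have hH1 : H 1 = E 1 * F 1 - F 1 * E 1 := by simpa using (hEF 1 1).symm
  have hsq : H 1 ^ 2 = E 1 * F 1 + F 1 * E 1 := by
    rw [pow_two]
    nth_rewrite 2 [hH1]
    rw [mul_sub, ← mul_assoc, ← mul_assoc, hHE1, hHF1]
    noncomm_ring
  have hPE : ∀ a, (1 - H 1 ^ 2) * E a = 0 := fun a => by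
    rw [sub_mul, pow_two, mul_assoc, hHE1, hHE1, one_mul, sub_self]
  have hPF : ∀ a, (1 - H 1 ^ 2) * F a = 0 := fun a => by
    rw [sub_mul, pow_two, mul_assoc, hHF1, mul_neg, hHF1, one_mul, neg_neg, sub_self]
  have hEP : ∀ a, E a * (1 - H 1 ^ 2) = 0 := fun a => by
    rw [mul_sub, pow_two, ← mul_assoc, hEH1, neg_mul, hEH1, mul_one, neg_neg, sub_self]
  have hFP : ∀ a, F a * (1 - H 1 ^ 2) = 0 := fun a => by
    rw [mul_sub, pow_two, ← mul_assoc, hFH1, hFH1, mul_one, sub_self]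
  have hPP : (1 - H 1 ^ 2) * (1 - H 1 ^ 2) = 1 - H 1 ^ 2 := by
    nth_rewrite 2 [hsq]
    rw [mul_sub, mul_add, ← mul_assoc, ← mul_assoc, hPE, hPF]
    simp
  have hsum : 1 - H 1 ^ 2 + E 1 * F 1 + F 1 * E 1 = 1 := by rw [hsq]; abel
  generalize 1 - H 1 ^ 2 = P at *
  refine ⟨?_, ?_, fun a => ?_⟩
  · simp only [mul_add, mul_sub, add_mul, sub_mul, hPP, hPE, hPF, hEP, hFP, hEE, hFF]
    rw [← hsum]; abel
  · simp only [mul_add, mul_sub, add_mul, sub_mul, hPP, hPE, hPF, hEP, hFP, hEE, hFF]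
    rw [← hsum]; abel
  · have hFEF : F 1 * E a * F 1 = F a := by
      rw [mul_assoc, sub_eq_iff_eq_add.mp (hEF a 1), mul_one, mul_add, hFH, ← mul_assoc, hFF,
        zero_mul, add_zero]
    rw [sub_mul, add_mul, hPE, hEE]
    simp only [mul_add, mul_sub, add_mul, sub_mul, zero_mul, hFEF, mul_assoc (F 1) (E a) P,
      mul_assoc (F 1) (E a) (E 1), hEP, hEE]
    simp

theorem smul_sl2e_bracket_smul_sl2f {K : Type*} [Field K] (a b : K) :
    ⁅a • sl2e K, b • sl2f K⁆ = (a * b) • sl2h K := by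
  ext i j
  fin_cases i <;> fin_cases j <;>
    simp [sl2e, sl2f, sl2h, Ring.lie_def, mul_comm]

theorem smul_sl2h_bracket_smul_sl2e {K : Type*} [Field K] (a b : K) :
    ⁅a • sl2h K, b • sl2e K⁆ = (a * b) • sl2e K + (a * b) • sl2e K := by
  ext i j
  fin_cases i <;> fin_cases j <;>
    simp [sl2e, sl2h, Ring.lie_def, Matrix.vecMul, dotProduct, Matrix.single_apply]; ring

theorem smul_sl2h_bracket_smul_sl2f {K : Type*} [Field K] (a b : K) :
    ⁅a • sl2h K, b • sl2f K⁆ = -((a * b) • sl2f K + (a * b) • sl2f K) := by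
  ext i j
  fin_cases i <;> fin_cases j <;>
    simp [sl2f, sl2h, Ring.lie_def, Matrix.vecMul, dotProduct, Matrix.single_apply]; ring

theorem stmt8 (K V : Type*) [Field K] (hchar : ringChar K ≠ 2) [AddCommGroup V]
    -- `ρ : 𝔤 → End_ℤ(V)` additive, preserving brackets (a 𝔤-module structure on `V`)
    (ρ : sl2 K →+ AddMonoid.End V)
    (hbracket : ∀ x y : sl2 K, ρ ⁅x, y⁆ = ρ x * ρ y - ρ y * ρ x)
    -- quadraticity
    (hquadE : ∀ lam mu : K, ρ (lam • sl2e K) * ρ (mu • sl2e K) = 0)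
    (hquadF : ∀ lam mu : K, ρ (lam • sl2f K) * ρ (mu • sl2f K) = 0)
    (ω ω' : AddMonoid.End V)
    (hω : ω = 1 - (ρ (sl2h K)) ^ 2 + ρ (sl2e K) - ρ (sl2f K))
    (hω' : ω' = 1 - (ρ (sl2h K)) ^ 2 - ρ (sl2e K) + ρ (sl2f K)) :
    ω * ω' = 1 ∧ ω' * ω = 1 ∧
      ∀ lam : K, ω * ρ (lam • sl2e K) * ω' = - ρ (lam • sl2f K) := by
  subst hω hω'
  have h2 : (2 : K) ≠ 0 := Ring.two_ne_zero hchar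
  let lift (x : sl2 K) : K →+ AddMonoid.End V := ρ.comp ((smulAddHom K (sl2 K)).flip x)
  have := quadratic_weyl h2 (lift (sl2e K)) (lift (sl2f K)) (lift (sl2h K)) hquadE hquadF
    (fun a b => by
      change ρ _ * ρ _ - ρ _ * ρ _ = ρ _
      rw [← hbracket]; exact congrArg ρ (smul_sl2e_bracket_smul_sl2f a b))
    (fun a b => by
      change ρ _ * ρ _ - ρ _ * ρ _ = ρ _ + ρ _
      rw [← hbracket, ← map_add]; exact congrArg ρ (smul_sl2h_bracket_smul_sl2e a b))
    (fun a b => by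
      change ρ _ * ρ _ - ρ _ * ρ _ = -(ρ _ + ρ _)
      rw [← hbracket, ← map_add, ← map_neg]; exact congrArg ρ (smul_sl2h_bracket_smul_sl2f a b))
  have lift_one (x : sl2 K) : lift x 1 = ρ x := congrArg ρ (one_smul K x)
  simp only [lift_one] at this
  exact this
end
end

section
/- Let K be a field of characteristic ≠ 2, 𝔤 = sl₂(K) regarded as a Lie ring, and V a quadratic 𝔤-module. Set ω = id_V − ρ(h)² + ρ(e) − ρ(f) and ω' = id_V − ρ(h)² − ρ(e) + ρ(f) in End_ℤ(V). Then for every λ ∈ K: ω ∘ ρ(λh) ∘ ω' = −ρ(λh). (In particular ω normalises the image of the Cartan subring in End(V).) -/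
/-!
STATEMENT 9: Let K be a field of characteristic ≠ 2, 𝔤 = sl₂(K) regarded as a Lie ring,
and V a quadratic 𝔤-module.  Set ω = id_V − ρ(h)² + ρ(e) − ρ(f) and
ω' = id_V − ρ(h)² − ρ(e) + ρ(f) in End_ℤ(V).  Then for every λ ∈ K:
ω ∘ ρ(λh) ∘ ω' = −ρ(λh).
-/

open LieAlgebra.SpecialLinear

noncomputable section

/-- In a quadratic `sl₂`-triple of additive families, `E l * F m * E n` depends only on the product
`l * m * n` and equals `E (l * m * n)`. -/
theorem quadratic_triple_mul {K R : Type*} [Field K] [Ring R] (h2 : (2 : K) ≠ 0)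
    (E F H : K →+ R)
    (hEF : ∀ l m, H (l * m) = E l * F m - F m * E l)
    (hHE : ∀ l m, E (l * m) + E (l * m) = H l * E m - E m * H l)
    (hEE : ∀ l m, E l * E m = 0) (l m n : K) :
    E l * F m * E n = E (l * m * n) := by
  have left : ∀ l m n, H (l * m) * E n = E l * F m * E n := fun l m n => by
    rw [hEF, sub_mul, mul_assoc (F m), hEE, mul_zero, sub_zero]
  have right : ∀ l m n, E l * H (n * m) = -(E l * F m * E n) := fun l m n => by
    rw [hEF, mul_sub, ← mul_assoc, hEE, zero_mul, zero_sub, mul_assoc]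
  have moveLeft : ∀ l m n, E l * F m * E n = E (l * m) * F 1 * E n := fun l m n => by
    rw [← left, ← left, mul_one]
  have moveRight : ∀ l m n, E l * F m * E n = E l * F 1 * E (n * m) := fun l m n => by
    rw [← neg_inj, ← right, ← right, mul_one]
  have toLast : ∀ k, E k * F 1 * E 1 = E 1 * F 1 * E k := fun k => by
    rw [← one_mul k, ← moveLeft, moveRight, one_mul]
  have double : ∀ k, E 1 * F 1 * E k + E 1 * F 1 * E k = E k + E k := fun k => by
    have h := hHE 1 k
    rw [← mul_one (1 : K), left, right, sub_neg_eq_add] at h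
    simpa [toLast] using h.symm
  have single : ∀ k, E 1 * F 1 * E k = E k := fun k => by
    have h := double (k / 2)
    rwa [← mul_add, ← map_add, ← mul_two, div_mul_cancel₀ k h2] at h
  rw [moveLeft, ← mul_one (l * m), ← one_mul (l * m * 1), ← moveLeft, mul_one, moveRight,
    single, one_mul, mul_comm]

/-- In a quadratic `sl₂`-triple of additive families, the Weyl element inverts the image of the
Cartan subring. -/
theorem quadratic_triple_weyl {K R : Type*} [Field K] [Ring R] (h2 : (2 : K) ≠ 0)
    (E F H : K →+ R)
    (hEF : ∀ l m, H (l * m) = E l * F m - F m * E l)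
    (hHE : ∀ l m, E (l * m) + E (l * m) = H l * E m - E m * H l)
    (hHF : ∀ l m, F (l * m) + F (l * m) = F m * H l - H l * F m)
    (hEE : ∀ l m, E l * E m = 0) (hFF : ∀ l m, F l * F m = 0) (l : K) :
    (1 - H 1 ^ 2 + E 1 - F 1) * H l * (1 - H 1 ^ 2 - E 1 + F 1) = -H l := by
  have efe := quadratic_triple_mul h2 E F H hEF hHE hEE
  have fef := quadratic_triple_mul h2 F E (-H)
    (fun l m => by rw [AddMonoidHom.neg_apply, mul_comm l, hEF, neg_sub])
    (fun l m => by
      rw [hHF, AddMonoidHom.neg_apply, neg_mul, mul_neg, sub_neg_eq_add, neg_add_eq_sub]) hFF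
  have hE : ∀ l m, H l * E m = E (l * m) := fun l m => by
    rw [← mul_one l, hEF, sub_mul, mul_assoc (F 1), hEE, mul_zero, sub_zero, efe]
  have Eh : ∀ l m, E m * H l = -E (l * m) := fun l m => by
    rw [← mul_one l, hEF, mul_sub, ← mul_assoc, hEE, zero_mul, zero_sub, ← mul_assoc, efe,
      mul_one, mul_one, mul_comm]
  have hF : ∀ l m, H l * F m = -F (l * m) := fun l m => by
    rw [← mul_one l, hEF, sub_mul, mul_assoc (E l), hFF, mul_zero, zero_sub, fef]
    simp
  have Fh : ∀ l m, F m * H l = F (l * m) := fun l m => by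
    rw [← mul_one l, hEF, mul_sub, ← mul_assoc, ← mul_assoc, hFF, zero_mul, sub_zero, fef]
    simp [mul_comm]
  have swap : ∀ k, F k * E 1 = F 1 * E k := fun k => by
    calc F k * E 1 = F 1 * E 1 * F k * E 1 := by rw [fef, one_mul, one_mul]
      _ = F 1 * (E 1 * F k * E 1) := by simp only [mul_assoc]
      _ = F 1 * E k := by rw [efe, one_mul, mul_one]
  have hl : H l = E l * F 1 - F 1 * E l := by rw [← hEF, mul_one]
  have leftUnit : H 1 ^ 2 * H l = H l := by
    conv_lhs => rw [hl]
    simp only [pow_two, mul_assoc, mul_sub, ← mul_assoc (H 1) (E l), ← mul_assoc (H 1) (F 1),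
      hE, hF, neg_mul, mul_neg, one_mul, neg_neg]
    exact hl.symm
  have rightUnit : H l * H 1 ^ 2 = H l := by
    conv_lhs => rw [hl]
    simp only [pow_two, sub_mul, mul_assoc, Eh, Fh, mul_neg, neg_mul, one_mul, ← mul_assoc (E l),
      ← mul_assoc (F 1)]
    simp [hl]
  have conj : (E 1 - F 1) * H l * (F 1 - E 1) = -H l := by
    rw [sub_mul, Eh, Fh, mul_one, hl]
    simp only [sub_mul, mul_sub, neg_mul, hEE, hFF, swap]
    abel
  calc (1 - H 1 ^ 2 + E 1 - F 1) * H l * (1 - H 1 ^ 2 - E 1 + F 1)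
      = (H l - H 1 ^ 2 * H l) * (1 - H 1 ^ 2 - E 1 + F 1)
        + (E 1 - F 1) * (H l - H l * H 1 ^ 2) + (E 1 - F 1) * H l * (F 1 - E 1) := by noncomm_ring
    _ = -H l := by rw [leftUnit, rightUnit, conj]; simp

theorem lie_smul_sl2e_smul_sl2f {K : Type*} [Field K] (l m : K) :
    ⁅l • sl2e K, m • sl2f K⁆ = (l * m) • sl2h K := by
  apply Subtype.ext
  ext i j
  fin_cases i <;> fin_cases j <;>
    simp [sl2e, sl2f, sl2h, Ring.lie_def, mul_comm]

theorem lie_smul_sl2h_smul_sl2e {K : Type*} [Field K] (l m : K) :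
    ⁅l • sl2h K, m • sl2e K⁆ = (l * m) • sl2e K + (l * m) • sl2e K := by
  apply Subtype.ext
  ext i j
  fin_cases i <;> fin_cases j <;>
    simp [sl2e, sl2h, Ring.lie_def, Matrix.mul_apply, Matrix.vecMul, Matrix.vecHead, Matrix.vecTail,
      Matrix.single_apply, mul_comm]
  all_goals ring

theorem lie_smul_sl2f_smul_sl2h {K : Type*} [Field K] (l m : K) :
    ⁅m • sl2f K, l • sl2h K⁆ = (l * m) • sl2f K + (l * m) • sl2f K := by
  apply Subtype.ext
  ext i j
  fin_cases i <;> fin_cases j <;>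
    simp [sl2f, sl2h, Ring.lie_def, Matrix.mul_apply, Matrix.vecMul, Matrix.vecHead, Matrix.vecTail,
      Matrix.single_apply, mul_comm]
  all_goals ring

theorem stmt9 (K V : Type*) [Field K] (hchar : ringChar K ≠ 2) [AddCommGroup V]
    (ρ : sl2 K →+ AddMonoid.End V)
    (hbracket : ∀ x y : sl2 K, ρ ⁅x, y⁆ = ρ x * ρ y - ρ y * ρ x)
    (hquadE : ∀ lam mu : K, ρ (lam • sl2e K) * ρ (mu • sl2e K) = 0)
    (hquadF : ∀ lam mu : K, ρ (lam • sl2f K) * ρ (mu • sl2f K) = 0)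
    (ω ω' : AddMonoid.End V)
    (hω : ω = 1 - (ρ (sl2h K)) ^ 2 + ρ (sl2e K) - ρ (sl2f K))
    (hω' : ω' = 1 - (ρ (sl2h K)) ^ 2 - ρ (sl2e K) + ρ (sl2f K)) :
    ∀ lam : K, ω * ρ (lam • sl2h K) * ω' = - ρ (lam • sl2h K) := by
  intro lam
  let family (x : sl2 K) : K →+ AddMonoid.End V :=
    ρ.comp ((LinearMap.toSpanSingleton K (sl2 K) x).toAddMonoidHom)
  have key := quadratic_triple_weyl (Ring.two_ne_zero hchar)
    (family (sl2e K)) (family (sl2f K)) (family (sl2h K))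
    (fun l m => by
      change ρ _ = ρ (l • sl2e K) * ρ (m • sl2f K) - ρ (m • sl2f K) * ρ (l • sl2e K)
      rw [← hbracket, lie_smul_sl2e_smul_sl2f]; rfl)
    (fun l m => by
      change ρ _ + ρ _ = ρ (l • sl2h K) * ρ (m • sl2e K) - ρ (m • sl2e K) * ρ (l • sl2h K)
      rw [← hbracket, lie_smul_sl2h_smul_sl2e, map_add]; rfl)
    (fun l m => by
      change ρ _ + ρ _ = ρ (m • sl2f K) * ρ (l • sl2h K) - ρ (l • sl2h K) * ρ (m • sl2f K)
      rw [← hbracket, lie_smul_sl2f_smul_sl2h, map_add]; rfl)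
    hquadE hquadF lam
  simpa [family, hω, hω'] using key
end
end

section
/- Let Φ be a finite crystallographic irreducible root system with a base Φ_s, and let μ be a vector in the span of Φ which is nonzero, dominant (⟨μ, α∨⟩ ≥ 0 for every simple root α), and small. Then there is exactly one simple root α with ⟨μ, α∨⟩ = 1, and ⟨μ, β∨⟩ = 0 for every simple root β ≠ α. (In other words, a nonzero small dominant vector is a fundamental weight.) -/
/-!
STATEMENT 15: Let Φ be a finite crystallographic irreducible root system with a base Φ_s,
and let μ be a vector in the span of Φ which is nonzero, dominant (⟨μ, α∨⟩ ≥ 0 for every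
simple root α), and small.  Then there is exactly one simple root α with ⟨μ, α∨⟩ = 1, and
⟨μ, β∨⟩ = 0 for every simple root β ≠ α.  (A nonzero small dominant vector is a
fundamental weight.)
-/

noncomputable section

/-- A vector `μ` is *small* if `⟨w(μ), γ∨⟩ ∈ {−1, 0, 1}` for every element `w` of the Weyl
group and every root `γ`. -/
def RootPairing.IsSmall {ι R M N : Type*} [CommRing R] [AddCommGroup M] [Module R M]
    [AddCommGroup N] [Module R N] (P : RootPairing ι R M N) (μ : M) : Prop :=
  ∀ w ∈ Subgroup.closure (Set.range P.reflection), ∀ j : ι, P.coroot' j (w μ) ∈ ({-1, 0, 1} : Set R)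

/-- `b` indexes a *base* (a set of simple roots) of the root system: the simple roots are
linearly independent and every root is a ℤ-combination of simple roots with coefficients
all non-negative or all non-positive. -/
def RootPairing.IsBase {ι R M N : Type*} [CommRing R] [AddCommGroup M] [Module R M]
    [AddCommGroup N] [Module R N] [Fintype ι] (P : RootPairing ι R M N) (b : Set ι) : Prop :=
  LinearIndependent R (fun a : b => P.root a) ∧
    ∀ k : ι, ∃ c : ι → ℤ, (∀ a : ι, a ∉ b → c a = 0) ∧
      ((∀ a : ι, 0 ≤ c a) ∨ (∀ a : ι, c a ≤ 0)) ∧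
      P.root k = ∑ a : ι, c a • P.root a

/-- Irreducibility, expressed via the base: the Dynkin diagram of the base admits no
partition into two nonempty mutually orthogonal parts. -/
def RootPairing.IsIrreducibleBase {ι R M N : Type*} [CommRing R] [AddCommGroup M]
    [Module R M] [AddCommGroup N] [Module R N] (P : RootPairing ι R M N) (b : Set ι) :
    Prop :=
  ∀ t ⊆ b, t.Nonempty → (∀ a ∈ t, ∀ c ∈ b \ t, P.pairing a c = 0) → t = b

namespace RootPairing

/-- A vector annihilated by all simple coroots of a root system is zero. -/
lemma Base.eq_zero_of_forall_coroot'_eq_zero {ι R M N : Type*} [CommRing R]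
    [AddCommGroup M] [Module R M] [AddCommGroup N] [Module R N]
    {P : RootPairing ι R M N} [P.IsRootSystem] (b : P.Base) {x : M}
    (hx : ∀ a ∈ b.support, P.coroot' a x = 0) : x = 0 := by
  refine P.eq_zero_iff_forall_coroot'_eq_zero.mpr fun i ↦ ?_
  have hle : Submodule.span ℤ (P.coroot '' b.support) ≤
      (LinearMap.ker (P.toLinearMap x)).restrictScalars ℤ := by
    rw [Submodule.span_le]
    rintro - ⟨a, ha, rfl⟩
    exact hx a ha
  exact hle (b.coroot_mem_span_int i)

variable {ι R M N : Type*} [Field R] [LinearOrder R] [IsStrictOrderedRing R]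
  [AddCommGroup M] [Module R M] [AddCommGroup N] [Module R N] [Fintype ι]
  {P : RootPairing ι R M N}

/-- A set of simple roots in the sense of `RootPairing.IsBase` gives a `RootPairing.Base`. -/
def IsBase.toBase [P.IsRootSystem] [P.IsCrystallographic] [P.IsReduced] {b : Set ι}
    (hb : P.IsBase b) : P.Base :=
  Base.mk' P b hb.1 fun k ↦ by
    have key (c : ι → ℤ) (hc : ∀ a, a ∉ b → c a = 0) (hpos : ∀ a, 0 ≤ c a) :
        ∑ a, c a • P.root a ∈ AddSubmonoid.closure (P.root '' b) := by
      refine sum_mem fun a _ ↦ ?_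
      by_cases ha : a ∈ b
      · obtain ⟨n, hn⟩ := Int.eq_ofNat_of_zero_le (hpos a)
        rw [hn, natCast_zsmul]
        exact nsmul_mem (AddSubmonoid.subset_closure (Set.mem_image_of_mem _ ha)) n
      · simp [hc a ha]
    obtain ⟨c, hc, hpos | hneg, hk⟩ := hb.2 k
    · exact Or.inl (hk ▸ key c hc hpos)
    · refine Or.inr ?_
      have := key (fun a ↦ -c a) (fun a ha ↦ by simp [hc a ha]) (fun a ↦ by simpa using hneg a)
      simpa [hk] using this

/-- Given an irreducible base and one of its simple roots, some coroot is a combination of simple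
coroots in which every simple coroot has coefficient at least one. -/
lemma Base.exists_coroot_eq_sum_forall_one_le [P.IsCrystallographic] (b : P.Base)
    (hirr : P.IsIrreducibleBase b.support) {a : ι} (ha : a ∈ b.support) :
    ∃ (k : ι) (f : ι → ℤ), P.coroot k = ∑ i ∈ b.support, f i • P.coroot i ∧
      ∀ i ∈ b.support, 1 ≤ f i := by
  classical
  let good (t : Finset ι) : Prop := a ∈ t ∧ ∃ (k : ι) (f : ι → ℤ),
    P.coroot k = ∑ i ∈ t, f i • P.coroot i ∧ ∀ i ∈ t, 1 ≤ f i
  have hne : (b.support.powerset.filter good).Nonempty :=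
    ⟨{a}, Finset.mem_filter.mpr ⟨by simpa using ha, by simp, a, 1, by simp, by simp⟩⟩
  obtain ⟨t, ht, hmax⟩ := Finset.exists_max_image _ Finset.card hne
  simp only [Finset.mem_filter, Finset.mem_powerset] at ht hmax
  obtain ⟨htb, hat, k, f, hk, hf⟩ := ht
  suffices t = b.support by exact ⟨k, f, this ▸ hk, this ▸ hf⟩
  rw [← Finset.coe_inj]
  refine hirr t (by exact_mod_cast htb) ⟨a, hat⟩ fun d hd c hc ↦ ?_
  by_contra hdc
  obtain ⟨hcb, hct⟩ : c ∈ b.support ∧ c ∉ t := by simpa using hc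
  have hd : d ∈ t := hd
  have hle (i : ι) (hi : i ∈ t) : P.pairingIn ℤ c i ≤ 0 :=
    b.pairingIn_le_zero_of_ne (by rintro rfl; exact hct hi) hcb (htb hi)
  have hlt : P.pairingIn ℤ c d < 0 := by
    refine lt_of_le_of_ne (hle d hd) fun h ↦ hdc ?_
    rw [P.pairing_eq_zero_iff', ← P.algebraMap_pairingIn ℤ, h, map_zero]
  have hsum : P.pairingIn ℤ c k = ∑ i ∈ t, f i * P.pairingIn ℤ c i := by
    apply FaithfulSMul.algebraMap_injective ℤ R
    simp_rw [map_sum, map_mul, algebraMap_pairingIn, ← root_coroot_eq_pairing, hk, map_sum,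
      map_zsmul, zsmul_eq_mul, algebraMap_int_eq, Int.coe_castRingHom]
  have hneg : P.pairingIn ℤ c k < 0 := by
    rw [hsum]
    refine Finset.sum_neg' (fun i hi ↦ ?_) ⟨d, hd, ?_⟩
    · exact mul_nonpos_of_nonneg_of_nonpos (by linarith [hf i hi]) (hle i hi)
    · exact mul_neg_of_pos_of_neg (by linarith [hf d hd]) hlt
  have hcard := hmax (insert c t) ⟨Finset.insert_subset hcb htb, Finset.mem_insert_of_mem hat,
    P.reflectionPerm c k, Function.update f c (-P.pairingIn ℤ c k), ?_, ?_⟩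
  · rw [Finset.card_insert_of_notMem hct] at hcard
    omega
  · rw [Finset.sum_insert hct, coroot_reflectionPerm, coreflection_apply_coroot, hk,
      Function.update_self, ← P.algebraMap_pairingIn ℤ, algebraMap_int_eq, Int.coe_castRingHom,
      Int.cast_smul_eq_zsmul, neg_smul, sub_eq_neg_add]
    congr 1
    refine Finset.sum_congr rfl fun i hi ↦ ?_
    rw [Function.update_of_ne (by rintro rfl; exact hct hi)]
  · intro i hi
    rcases eq_or_ne i c with rfl | hic
    · rw [Function.update_self]
      omega
    · rw [Function.update_of_ne hic]
      exact hf i (Finset.mem_of_mem_insert_of_ne hi hic)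

end RootPairing

theorem stmt15 {ι R M N : Type*} [Field R] [LinearOrder R] [IsStrictOrderedRing R]
    [AddCommGroup M] [Module R M]
    [AddCommGroup N] [Module R N] [Fintype ι]
    (P : RootPairing ι R M N) [P.IsRootSystem]
    (hcrys : P.IsCrystallographic)
    (hred : P.IsReduced)
    -- the base Φ_s, and irreducibility of Φ
    (b : Set ι) (hbase : P.IsBase b)
    (hirr : P.IsIrreducibleBase b)
    -- μ is in the span of Φ, nonzero, dominant and small
    (μ : M) (hspan : μ ∈ Submodule.span R (Set.range P.root)) (hμ : μ ≠ 0)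
    (hdom : ∀ a ∈ b, 0 ≤ P.coroot' a μ)
    (hsmall : P.IsSmall μ) :
    -- exactly one simple root pairs with μ to 1, and all the others pair to 0
    ∃ a ∈ b, P.coroot' a μ = 1 ∧
      ∀ c ∈ b, c ≠ a → P.coroot' c μ = 0 := by
  classical
  set B := hbase.toBase
  have hB (a : ι) : a ∈ B.support ↔ a ∈ b := by
    simp [B, RootPairing.IsBase.toBase, RootPairing.Base.mk']
  have hB' : (B.support : Set ι) = b := Set.ext hB
  have hval (i : ι) : P.coroot' i μ ∈ ({-1, 0, 1} : Set R) := by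
    simpa using hsmall 1 (one_mem _) i
  have hsimple (a : ι) (ha : a ∈ b) (h0 : P.coroot' a μ ≠ 0) : P.coroot' a μ = 1 := by
    rcases hval a with h | h | h
    · linarith [hdom a ha]
    · exact absurd h h0
    · exact h
  obtain ⟨a, ha, ha0⟩ : ∃ a ∈ b, P.coroot' a μ ≠ 0 := by
    by_contra! h
    exact hμ (B.eq_zero_of_forall_coroot'_eq_zero fun a ha ↦ h a ((hB a).mp ha))
  refine ⟨a, ha, hsimple a ha ha0, fun c hc hca ↦ ?_⟩
  by_contra hc0
  obtain ⟨k, f, hk, hf⟩ :=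
    B.exists_coroot_eq_sum_forall_one_le (hB'.symm ▸ hirr) ((hB a).mpr ha)
  have hsum : P.coroot' k μ = ∑ i ∈ B.support, (f i : R) * P.coroot' i μ := by
    change P.toLinearMap μ (P.coroot k) = _
    rw [hk, map_sum]
    exact Finset.sum_congr rfl fun i _ ↦ by rw [map_zsmul, zsmul_eq_mul]; rfl
  have hsub : ({a, c} : Finset ι) ⊆ B.support := by
    simp [Finset.insert_subset_iff, hB, ha, hc]
  have hf' (i : ι) (hi : i ∈ B.support) : (1 : R) ≤ f i := by exact_mod_cast hf i hi
  have hge : ∑ i ∈ {a, c}, (f i : R) * P.coroot' i μ ≤ P.coroot' k μ := by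
    rw [hsum]
    refine Finset.sum_le_sum_of_subset_of_nonneg hsub fun i hi _ ↦ ?_
    exact mul_nonneg (zero_le_one.trans (hf' i hi)) (hdom i ((hB i).mp hi))
  rw [Finset.sum_pair hca.symm, hsimple a ha ha0, hsimple c hc hc0] at hge
  have h1 := hf' a ((hB a).mpr ha)
  have h2 := hf' c ((hB c).mpr hc)
  rcases hval k with h | h | h
  · linarith
  · linarith
  · linarith [Set.mem_singleton_iff.mp h]
end
end

section
/- Let Φ be a finite crystallographic root system whose base consists of two simple roots α, β with ⟨α, β∨⟩ = −1 and ⟨β, α∨⟩ = −3 (type G₂). Then there is no dominant small vector μ in the span of Φ with (⟨μ, α∨⟩, ⟨μ, β∨⟩) ≠ (0, 0). Concretely: if ⟨μ, α∨⟩ = 1 and ⟨μ, β∨⟩ = 0 then ⟨σ_β(σ_α(μ)), α∨⟩ = 2, and if ⟨μ, β∨⟩ = 1 then ⟨σ_β(μ), α∨⟩ = ⟨μ, α∨⟩ + 3 ≥ 3; in either case μ is not small. -/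
/-!
STATEMENT 16: Let Φ be a finite crystallographic root system whose base consists of two
simple roots α, β with ⟨α, β∨⟩ = −1 and ⟨β, α∨⟩ = −3 (type G₂).  Then there is no dominant
small vector μ in the span of Φ with (⟨μ, α∨⟩, ⟨μ, β∨⟩) ≠ (0, 0).  Concretely: if
⟨μ, α∨⟩ = 1 and ⟨μ, β∨⟩ = 0 then ⟨σ_β(σ_α(μ)), α∨⟩ = 2, and if ⟨μ, β∨⟩ = 1 (μ dominant)
then ⟨σ_β(μ), α∨⟩ = ⟨μ, α∨⟩ + 3 ≥ 3; in either case μ is not small.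
-/

noncomputable section

theorem stmt16 {ι R M N : Type*} [Field R] [LinearOrder R] [IsStrictOrderedRing R] [AddCommGroup M] [Module R M]
    [AddCommGroup N] [Module R N] [Fintype ι]
    (P : RootPairing ι R M N) [P.IsRootSystem]
    (hcrys : P.IsCrystallographic)
    (hred : P.IsReduced)
    -- the base consists of the two simple roots α = root i, β = root j, of type G₂
    (i j : ι) (hne : i ≠ j)
    (hij : P.pairing i j = -1)
    (hji : P.pairing j i = -3) :
    -- no dominant small vector in the span of Φ has (⟨μ,α∨⟩, ⟨μ,β∨⟩) ≠ (0,0)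
    (∀ μ ∈ Submodule.span R (Set.range P.root),
      0 ≤ P.coroot' i μ → 0 ≤ P.coroot' j μ →
      P.IsSmall μ →
      P.coroot' i μ = 0 ∧ P.coroot' j μ = 0) ∧
    -- if ⟨μ,α∨⟩ = 1 and ⟨μ,β∨⟩ = 0 then ⟨σ_β(σ_α(μ)), α∨⟩ = 2 and μ is not small
    (∀ μ : M, P.coroot' i μ = 1 → P.coroot' j μ = 0 →
      P.coroot' i
          (P.reflection j (P.reflection i μ)) = 2 ∧
        ¬ P.IsSmall μ) ∧
    -- if μ is dominant and ⟨μ,β∨⟩ = 1 then ⟨σ_β(μ), α∨⟩ = ⟨μ,α∨⟩ + 3 ≥ 3 and μ is not small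
    (∀ μ : M, 0 ≤ P.coroot' i μ → P.coroot' j μ = 1 →
      P.coroot' i (P.reflection j μ) =
          P.coroot' i μ + 3 ∧
        (3 : R) ≤ P.coroot' i (P.reflection j μ) ∧
        ¬ P.IsSmall μ) := by
  have hrefl (k l : ι) (μ : M) : P.coroot' k (P.reflection l μ) =
      P.coroot' k μ - P.coroot' l μ * P.pairing l k := by
    simp [RootPairing.reflection_apply]
  have hii := P.pairing_same i
  have hgen (k : ι) : P.reflection k ∈ Subgroup.closure (Set.range P.reflection) :=
    Subgroup.subset_closure ⟨k, rfl⟩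
  have htwo (μ : M) (hi : P.coroot' i μ = 1) (hj : P.coroot' j μ = 0) :
      P.coroot' i (P.reflection j (P.reflection i μ)) = 2 := by
    simp only [hrefl, hi, hj, hij, hji, hii]
    norm_num
  have hthree (μ : M) (hj : P.coroot' j μ = 1) :
      P.coroot' i (P.reflection j μ) = P.coroot' i μ + 3 := by
    rw [hrefl, hj, hji]
    ring
  have hle (μ : M) (hμ : P.IsSmall μ) (w) (hw : w ∈ Subgroup.closure (Set.range P.reflection))
      (k : ι) : P.coroot' k (w μ) ≤ 1 := by
    rcases hμ w hw k with h | h | h <;> rw [h] <;> norm_num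
  have hsmall_two (μ : M) (hi : P.coroot' i μ = 1) (hj : P.coroot' j μ = 0) :
      ¬ P.IsSmall μ := fun hμ => by
    have h : P.coroot' i (P.reflection j (P.reflection i μ)) ≤ 1 :=
      hle μ hμ _ (mul_mem (hgen j) (hgen i)) i
    rw [htwo μ hi hj] at h
    norm_num at h
  have hsmall_three (μ : M) (hi : 0 ≤ P.coroot' i μ) (hj : P.coroot' j μ = 1) :
      ¬ P.IsSmall μ := fun hμ => by
    have h := hle μ hμ _ (hgen j) i
    rw [hthree μ hj] at h
    linarith
  refine ⟨fun μ _ hi hj hμ => ?_, fun μ hi hj => ⟨htwo μ hi hj, hsmall_two μ hi hj⟩,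
    fun μ hi hj => ⟨hthree μ hj, by rw [hthree μ hj]; linarith, hsmall_three μ hi hj⟩⟩
  have hzero_one (k : ι) (hk : 0 ≤ P.coroot' k μ) : P.coroot' k μ = 0 ∨ P.coroot' k μ = 1 := by
    rcases hμ 1 (one_mem _) k with h | h | h <;> rw [LinearEquiv.coe_one, id] at h
    · linarith
    · exact Or.inl h
    · exact Or.inr h
  rcases hzero_one j hj with h | h
  · rcases hzero_one i hi with h' | h'
    · exact ⟨h', h⟩
    · exact absurd hμ (hsmall_two μ h' h)
  · exact absurd hμ (hsmall_three μ hi h)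
end
end
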